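/- Let f : ℝ² → ℝ be bounded and continuous, and let X : ℝ² → ℝ² be Lipschitz with Lipschitz constant L ≥ 1. Then ∫₀¹ sup_{|x−y|≤r} |f(X(x)) − f(X(y))| dr/r ≤ |f|_{C_D} + 2‖f‖_{L^∞} · ln L. -/

import Mathlib

open MeasureTheory Set

noncomputable section

abbrev R2 : Type := EuclideanSpace ℝ (Fin 2)

/-- The modulus of continuity of `f` at scale `r`: `sup_{|x-y| ≤ r} |f(x) - f(y)|`. -/
def oscAt (f : R2 → ℝ) (r : ℝ) : ℝ :=
  ⨆ p : {p : R2 × R2 // dist p.1 p.2 ≤ r}, |f p.val.1 - f p.val.2|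

theorem bddAbove_osc {f : R2 → ℝ} {M : ℝ} (hM : ∀ x, |f x| ≤ M) (r : ℝ) :
    BddAbove (range fun p : {p : R2 × R2 // dist p.1 p.2 ≤ r} => |f p.val.1 - f p.val.2|) := by
  refine ⟨M + M, ?_⟩
  rintro _ ⟨p, rfl⟩
  exact (abs_sub _ _).trans (add_le_add (hM _) (hM _))

theorem oscAt_le_two_mul_iSup {f : R2 → ℝ} (hf : BddAbove (range fun x => |f x|)) {r : ℝ}
    (hr : 0 ≤ r) : oscAt f r ≤ 2 * ⨆ x, |f x| := by
  have : Nonempty {p : R2 × R2 // dist p.1 p.2 ≤ r} := ⟨⟨(0, 0), by simpa using hr⟩⟩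
  refine ciSup_le fun p => (abs_sub _ _).trans ?_
  have h1 := le_ciSup hf p.val.1
  have h2 := le_ciSup hf p.val.2
  linarith

theorem oscAt_comp_le {f : R2 → ℝ} {M : ℝ} (hM : ∀ x, |f x| ≤ M) {X : R2 → R2} {L : ℝ}
    (hL : 0 ≤ L) (hX : ∀ x y, dist (X x) (X y) ≤ L * dist x y) {r : ℝ} (hr : 0 ≤ r) :
    oscAt (fun x => f (X x)) r ≤ oscAt f (L * r) := by
  have : Nonempty {p : R2 × R2 // dist p.1 p.2 ≤ r} := ⟨⟨(0, 0), by simpa using hr⟩⟩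
  exact ciSup_le fun p => le_ciSup (bddAbove_osc hM (L * r))
    ⟨(X p.val.1, X p.val.2), (hX _ _).trans (mul_le_mul_of_nonneg_left p.2 hL)⟩

/-- The measure `dr / r` is invariant under dilations. -/
theorem lintegral_Ioo_comp_mul_div (g : ℝ → ℝ) {L : ℝ} (hL : 0 < L) :
    ∫⁻ r in Ioo (0 : ℝ) 1, ENNReal.ofReal (g (L * r) / r) =
      ∫⁻ s in Ioo (0 : ℝ) L, ENNReal.ofReal (g s / s) := by
  have himage : (fun r => L * r) '' Ioo (0 : ℝ) 1 = Ioo 0 L := by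
    rw [image_mul_left_Ioo hL, mul_zero, mul_one]
  rw [← himage, lintegral_image_eq_lintegral_abs_deriv_mul measurableSet_Ioo
    (fun r _ => (hasDerivAt_const_mul L).hasDerivWithinAt)
    (mul_right_injective₀ hL.ne').injOn]
  refine setLIntegral_congr_fun measurableSet_Ioo fun r hr => ?_
  have hr0 : r ≠ 0 := hr.1.ne'
  simp only [abs_of_pos hL]
  rw [← ENNReal.ofReal_mul hL.le]
  congr 1
  field_simp

theorem lintegral_Ico_const_div {C L : ℝ} (hC : 0 ≤ C) (hL : 1 ≤ L) :
    ∫⁻ s in Ico (1 : ℝ) L, ENNReal.ofReal (C / s) = ENNReal.ofReal (C * Real.log L) := by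
  have hint : IntervalIntegrable (fun s => C / s) volume 1 L := by
    refine ContinuousOn.intervalIntegrable fun s hs => ?_
    rw [uIcc_of_le hL] at hs
    have hs0 : s ≠ 0 := (one_pos.trans_le hs.1).ne'
    exact (continuousAt_const.div continuousAt_id hs0).continuousWithinAt
  rw [setLIntegral_congr Ico_ae_eq_Ioc, ← ofReal_integral_eq_lintegral_ofReal hint.1,
    ← intervalIntegral.integral_of_le hL]
  · simp_rw [div_eq_mul_inv]
    rw [intervalIntegral.integral_const_mul, integral_inv_of_pos one_pos (by linarith), div_one]
  · refine (ae_restrict_iff' measurableSet_Ioc).2 (.of_forall fun s hs => ?_)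
    exact div_nonneg hC (one_pos.trans hs.1).le

/-- **Dini seminorm under composition with a Lipschitz map** (estimate (5.4)): for `f`
bounded and continuous and `X` Lipschitz with constant `L ≥ 1`,
`∫₀¹ sup_{|x-y|≤r} |f(X(x)) - f(X(y))| dr/r ≤ |f|_{C_D} + 2 ‖f‖_{L^∞} ln L`. -/
theorem dini_compose_lipschitz
    (f : R2 → ℝ) (hb : ∃ M : ℝ, ∀ x, |f x| ≤ M) (hc : Continuous f)
    (X : R2 → R2) (L : ℝ) (hL : 1 ≤ L)
    (hX : ∀ x y : R2, dist (X x) (X y) ≤ L * dist x y) :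
    (∫⁻ r in Ioo (0:ℝ) 1, ENNReal.ofReal (oscAt (fun x => f (X x)) r / r)) ≤
      (∫⁻ r in Ioo (0:ℝ) 1, ENNReal.ofReal (oscAt f r / r)) +
        ENNReal.ofReal (2 * (⨆ x, |f x|) * Real.log L) := by
  obtain ⟨M, hM⟩ := hb
  have hbdd : BddAbove (range fun x => |f x|) := ⟨M, by rintro _ ⟨x, rfl⟩; exact hM x⟩
  have hL0 : 0 < L := by linarith
  calc
    _ ≤ ∫⁻ r in Ioo (0 : ℝ) 1, ENNReal.ofReal (oscAt f (L * r) / r) := by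
      refine setLIntegral_mono' measurableSet_Ioo fun r hr => ENNReal.ofReal_le_ofReal ?_
      exact div_le_div_of_nonneg_right (oscAt_comp_le hM hL0.le hX hr.1.le) hr.1.le
    _ = ∫⁻ s in Ioo (0 : ℝ) 1 ∪ Ico 1 L, ENNReal.ofReal (oscAt f s / s) := by
      rw [lintegral_Ioo_comp_mul_div _ hL0, Ioo_union_Ico_eq_Ioo one_pos hL]
    _ ≤ (∫⁻ s in Ioo (0 : ℝ) 1, ENNReal.ofReal (oscAt f s / s)) +
        ∫⁻ s in Ico (1 : ℝ) L, ENNReal.ofReal (oscAt f s / s) := lintegral_union_le _ _ _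
    _ ≤ _ := by
      rw [← lintegral_Ico_const_div
        (mul_nonneg zero_le_two (Real.iSup_nonneg fun x => abs_nonneg (f x))) hL]
      refine add_le_add le_rfl
        (setLIntegral_mono' measurableSet_Ico fun s hs => ENNReal.ofReal_le_ofReal ?_)
      have hs0 : 0 ≤ s := zero_le_one.trans hs.1
      exact div_le_div_of_nonneg_right (oscAt_le_two_mul_iSup hbdd hs0) hs0
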